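/- Suppose x_i ≠ 1 for all i = 1, …, n, and S = Σ_{i=1}^n 1/(1 − x_i) equals 1 (so M is singular but the bordered matrix M̃(α) is nonsingular). Then for every real number α, every k ≥ 0, every vector w ∈ ℝ^k and every k×k real matrix C, det N = det M̃(α) · det C, where N = [[M, j, O],[jᵀ, α, wᵀ],[O, w, C]]. In particular, N is nonsingular if and only if C is nonsingular. -/

import Mathlib

open Matrix BigOperators

/-- `Mmat x` is the matrix with diagonal entries `x i` and all off-diagonal entries `1`. -/
def Mmat {n : ℕ} (x : Fin n → ℝ) : Matrix (Fin n) (Fin n) ℝ :=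
  Matrix.of fun i j => if i = j then x i else 1

/-- `Nmat x α w C` is the block matrix `[[M, j, O],[jᵀ, α, wᵀ],[O, w, C]]`. -/
def Nmat {n k : ℕ} (x : Fin n → ℝ) (α : ℝ) (w : Fin k → ℝ)
    (C : Matrix (Fin k) (Fin k) ℝ) :
    Matrix ((Fin n ⊕ Unit) ⊕ Fin k) ((Fin n ⊕ Unit) ⊕ Fin k) ℝ :=
  Matrix.fromBlocks
    (Matrix.fromBlocks (Mmat x) (fun _ _ => 1) (fun _ _ => 1) (fun _ _ => α))
    (Matrix.of fun p (j : Fin k) => Sum.elim (fun _ : Fin n => (0 : ℝ)) (fun _ : Unit => w j) p)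
    (Matrix.of fun (i : Fin k) p => Sum.elim (fun _ : Fin n => (0 : ℝ)) (fun _ : Unit => w i) p)
    C

/-- `Smat β w C` is the bordered matrix `[[β, wᵀ],[w, C]]`. -/
def Smat {k : ℕ} (β : ℝ) (w : Fin k → ℝ) (C : Matrix (Fin k) (Fin k) ℝ) :
    Matrix (Unit ⊕ Fin k) (Unit ⊕ Fin k) ℝ :=
  Matrix.fromBlocks (fun _ _ => β) (fun _ j => w j) (fun i _ => w i) C

/-- `Mtilde x α` is the bordered matrix whose top-left block is `Mmat x`, whose last row and
column are all ones, except the bottom-right corner entry which is `α`. -/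
def Mtilde {n : ℕ} (x : Fin n → ℝ) (α : ℝ) : Matrix (Fin n ⊕ Unit) (Fin n ⊕ Unit) ℝ :=
  Matrix.fromBlocks (Mmat x) (fun _ _ => 1) (fun _ _ => 1) (fun _ _ => α)

lemma Mmat_mulVec {n : ℕ} (x u : Fin n → ℝ) (i : Fin n) :
    (Mmat x *ᵥ u) i = (∑ j, u j) - (1 - x i) * u i := by
  have h : ∀ j, Mmat x i j * u j = u j - if i = j then (1 - x i) * u i else 0 := by
    intro j
    by_cases hij : i = j
    · subst hij
      simp only [Mmat, Matrix.of_apply, if_true]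
      ring
    · simp [Mmat, hij]
  simp [Matrix.mulVec, dotProduct, h, Finset.sum_sub_distrib]

lemma Mtilde_mulVec_inl {n : ℕ} (x u : Fin n → ℝ) (α t : ℝ) (i : Fin n) :
    (Mtilde x α *ᵥ Sum.elim u fun _ => t) (Sum.inl i) =
      (∑ j, u j) - (1 - x i) * u i + t := by
  rw [← Mmat_mulVec]
  simp [Mtilde, Matrix.fromBlocks, Matrix.mulVec, dotProduct]

lemma Mtilde_mulVec_inr {n : ℕ} (x u : Fin n → ℝ) (α t : ℝ) (a : Unit) :
    (Mtilde x α *ᵥ Sum.elim u fun _ => t) (Sum.inr a) = (∑ j, u j) + α * t := by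
  simp [Mtilde, Matrix.fromBlocks, Matrix.mulVec, dotProduct]

lemma det_Mtilde_ne_zero {n : ℕ} (x : Fin n → ℝ) (hx : ∀ i, x i ≠ 1)
    (hS : (∑ i, 1 / (1 - x i)) = 1) (α : ℝ) : (Mtilde x α).det ≠ 0 := by
  intro hdet
  obtain ⟨v, hv, hMv⟩ := Matrix.exists_mulVec_eq_zero_iff.mpr hdet
  obtain ⟨u, t, rfl⟩ : ∃ (u : Fin n → ℝ) (t : ℝ), v = Sum.elim u fun _ => t :=
    ⟨fun i => v (Sum.inl i), v (Sum.inr ()), by ext (i | i) <;> rfl⟩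
  have hu : ∀ i, u i = ((∑ j, u j) + t) * (1 / (1 - x i)) := by
    intro i
    have h := congrFun hMv (Sum.inl i)
    rw [Mtilde_mulVec_inl, Pi.zero_apply] at h
    have : 1 - x i ≠ 0 := sub_ne_zero.mpr (hx i).symm
    field_simp
    linarith
  have hsum : (∑ j, u j) = (∑ j, u j) + t :=
    calc (∑ j, u j) = ∑ i, ((∑ j, u j) + t) * (1 / (1 - x i)) :=
          Finset.sum_congr rfl fun i _ => hu i
      _ = (∑ j, u j) + t := by rw [← Finset.mul_sum, hS, mul_one]
  have ht : t = 0 := by linarith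
  have hs := congrFun hMv (Sum.inr ())
  rw [Mtilde_mulVec_inr, Pi.zero_apply, ht, mul_zero, add_zero] at hs
  apply hv
  ext (i | i)
  · simp [hu i, hs, ht]
  · simp [ht]

lemma det_Nmat {n : ℕ} (x : Fin n → ℝ) (hx : ∀ i, x i ≠ 1)
    (hS : (∑ i, 1 / (1 - x i)) = 1)
    (α : ℝ) {k : ℕ} (w : Fin k → ℝ) (C : Matrix (Fin k) (Fin k) ℝ) :
    (Nmat x α w C).det = (Mtilde x α).det * C.det := by
  set z : Fin n ⊕ Unit → ℝ := Sum.elim (fun i => 1 / (1 - x i)) fun _ => 0 with hz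
  set B : Matrix (Fin k) (Fin n ⊕ Unit) ℝ :=
    Matrix.of fun i p => Sum.elim (fun _ : Fin n => (0 : ℝ)) (fun _ : Unit => w i) p with hB
  have hMz : Mtilde x α *ᵥ z = Sum.elim (fun _ => 0) fun _ => 1 := by
    ext (i | i)
    · have : 1 - x i ≠ 0 := sub_ne_zero.mpr (hx i).symm
      rw [hz, Mtilde_mulVec_inl, hS, mul_one_div_cancel this]
      simp
    · rw [hz, Mtilde_mulVec_inr, hS]
      simp
  have hBz : B *ᵥ z = 0 := by
    ext i
    simp [hB, hz, Matrix.mulVec, dotProduct]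
  have hN : Nmat x α w C =
      Matrix.fromBlocks (Mtilde x α) 0 B C * Matrix.fromBlocks 1 (Matrix.vecMulVec z w) 0 1 := by
    rw [Matrix.fromBlocks_multiply, Matrix.mul_vecMulVec, Matrix.mul_vecMulVec, hMz, hBz]
    simp only [add_zero, zero_add, Matrix.mul_one, Matrix.mul_zero,
      Matrix.zero_vecMulVec]
    rw [Nmat, Mtilde]
    congr 1
    ext (p | p) j <;> simp [Matrix.vecMulVec_apply]
  rw [hN, Matrix.det_mul, Matrix.det_fromBlocks_zero₁₂, Matrix.det_fromBlocks_zero₂₁]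
  simp

/-- if `x i ≠ 1` for all `i` and `∑ i, 1/(1 - x i) = 1`, then
`det N = det M̃(α) * det C`; in particular `N` is nonsingular iff `C` is nonsingular. -/
theorem stmt_13 {n : ℕ} (hn : 1 ≤ n) (x : Fin n → ℝ) (hx : ∀ i, x i ≠ 1)
    (hS : (∑ i, 1 / (1 - x i)) = 1)
    (α : ℝ) {k : ℕ} (w : Fin k → ℝ) (C : Matrix (Fin k) (Fin k) ℝ) :
    (Nmat x α w C).det = (Mtilde x α).det * C.det ∧
      ((Nmat x α w C).det ≠ 0 ↔ C.det ≠ 0) := by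
  have h := det_Nmat x hx hS α w C
  exact ⟨h, by rw [h, mul_ne_zero_iff, and_iff_right (det_Mtilde_ne_zero x hx hS α)]⟩
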